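/- arXiv:0910.3253 — 6 statements merged into one kernel-verified Lean document; each statement's English description precedes it below -/
import Mathlib

section
/- A map φ: 𝒜 → ZMod 2 that is not identically 0 and not identically 1 is multiplicative (i.e., φ(A ∩ B) = φ(A)·φ(B) for all A,B ∈ 𝒜) if and only if there exist finitely many distinct elements α₁,…,α_m ∈ Ω (m ≥ 1) such that φ = α₁^* ⋯ α_m^*, i.e., φ(A) = α₁^*(A)·⋯·α_m^*(A) for every A ∈ 𝒜; equivalently, there is a nonempty set B ⊆ Ω such that φ(A) = 1 exactly when B ⊆ A. -/
/-- The containment map `ω^*`: `ω^*(A) = 1` if `ω ∈ A` and `0` otherwise. -/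
def containmentMap {Ω : Type*} [DecidableEq Ω] (ω : Ω) (A : Finset Ω) : ZMod 2 :=
  if ω ∈ A then 1 else 0

theorem ZMod.eq_one_iff_ne_zero_of_two (x : ZMod 2) : x = 1 ↔ x ≠ 0 := by
  revert x; decide

theorem ZMod.eq_iff_eq_one_iff_of_two (x y : ZMod 2) : x = y ↔ (x = 1 ↔ y = 1) := by
  revert x y; decide

theorem ZMod.mul_eq_one_iff_of_two (x y : ZMod 2) : x * y = 1 ↔ x = 1 ∧ y = 1 := by
  revert x y; decide

theorem prod_containmentMap_eq_one_iff {Ω : Type*} [DecidableEq Ω] (s A : Finset Ω) :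
    ∏ ω ∈ s, containmentMap ω A = 1 ↔ s ⊆ A := by
  rw [ZMod.eq_one_iff_ne_zero_of_two, Finset.prod_ne_zero_iff]
  simp [containmentMap, Finset.subset_iff]

/-- A multiplicative map that is not identically `0` is the indicator of the sets containing a
fixed set, namely a minimal set on which it takes the value `1`. -/
theorem exists_eq_one_iff_subset_of_map_inter {Ω : Type*} [DecidableEq Ω]
    {φ : Finset Ω → ZMod 2} (hφ0 : φ ≠ 0) (hφ : ∀ A B : Finset Ω, φ (A ∩ B) = φ A * φ B) :
    ∃ B : Finset Ω, ∀ A : Finset Ω, φ A = 1 ↔ B ⊆ A := by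
  obtain ⟨C, hC⟩ := Function.ne_iff.mp hφ0
  obtain ⟨B, hB, hmin⟩ := wellFounded_lt.has_min {A : Finset Ω | φ A = 1}
    ⟨C, (ZMod.eq_one_iff_ne_zero_of_two _).mpr hC⟩
  rw [Set.mem_ofPred_eq] at hB
  refine ⟨B, fun A => ⟨fun hA => ?_, fun hBA => ?_⟩⟩
  · by_contra hBA
    refine hmin (B ∩ A) (show φ (B ∩ A) = 1 by rw [hφ, hA, hB, one_mul]) ?_
    exact Finset.inter_subset_left.lt_of_ne (mt Finset.inter_eq_left.mp hBA)
  · have h := hφ B A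
    rwa [Finset.inter_eq_left.mpr hBA, hB, one_mul, eq_comm] at h

/-- A map `φ : 𝒜 → ZMod 2` with `φ ≠ 0, 1` is multiplicative iff
`φ = α₁^* ⋯ α_m^*` for finitely many distinct `α₁, …, α_m ∈ Ω` (`m ≥ 1`),
encoded as a nonempty `Finset`; equivalently there is a nonempty `B ⊆ Ω` with
`φ(A) = 1` exactly when `B ⊆ A`. -/
theorem statement_1 {Ω : Type*} [Fintype Ω] [DecidableEq Ω]
    (φ : Finset Ω → ZMod 2) (hφ0 : φ ≠ 0) (hφ1 : φ ≠ 1) :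
    ((∀ A B : Finset Ω, φ (A ∩ B) = φ A * φ B) ↔
      ∃ s : Finset Ω, s.Nonempty ∧
        ∀ A : Finset Ω, φ A = ∏ ω ∈ s, containmentMap ω A) ∧
    ((∀ A B : Finset Ω, φ (A ∩ B) = φ A * φ B) ↔
      ∃ B : Finset Ω, B.Nonempty ∧ ∀ A : Finset Ω, (φ A = 1 ↔ B ⊆ A)) := by
  have key : (∀ A B : Finset Ω, φ (A ∩ B) = φ A * φ B) ↔
      ∃ B : Finset Ω, B.Nonempty ∧ ∀ A : Finset Ω, (φ A = 1 ↔ B ⊆ A) := by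
    constructor
    · intro hφ
      obtain ⟨B, hB⟩ := exists_eq_one_iff_subset_of_map_inter hφ0 hφ
      refine ⟨B, Finset.nonempty_iff_ne_empty.mpr ?_, hB⟩
      rintro rfl
      exact hφ1 (funext fun A => (hB A).mpr (Finset.empty_subset A))
    · rintro ⟨B, -, hB⟩ A A'
      rw [ZMod.eq_iff_eq_one_iff_of_two, ZMod.mul_eq_one_iff_of_two, hB, hB, hB,
        Finset.subset_inter_iff]
  refine ⟨key.trans (exists_congr fun s => and_congr_right fun _ => forall_congr' fun A => ?_), key⟩
  rw [ZMod.eq_iff_eq_one_iff_of_two (φ A) (∏ ω ∈ s, _), prod_containmentMap_eq_one_iff]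
end

section
/- A map φ: 𝒜 → ZMod 2 is grade-2 additive if and only if it is a polynomial of degree at most two in the containment maps: there exist coefficients a: Ω → ZMod 2 and b: Ω × Ω → ZMod 2 such that φ(A) = Σ_{ω ∈ Ω} a(ω)·ω^*(A) + Σ_{(ω,ω') ∈ Ω×Ω} b(ω,ω')·ω^*(A)·ω'^*(A) for all A ∈ 𝒜. -/
/-- `φ : 𝒜 → ZMod 2` is grade-2 additive:
`φ(A ∪ B ∪ C) = φ(A∪B) + φ(A∪C) + φ(B∪C) + φ(A) + φ(B) + φ(C)`
for all mutually disjoint `A, B, C`. -/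
def Grade2Additive {Ω : Type*} [DecidableEq Ω] (φ : Finset Ω → ZMod 2) : Prop :=
  ∀ A B C : Finset Ω, Disjoint A B → Disjoint A C → Disjoint B C →
    φ (A ∪ B ∪ C) = φ (A ∪ B) + φ (A ∪ C) + φ (B ∪ C) + φ A + φ B + φ C

theorem containmentMap_union {Ω : Type*} [DecidableEq Ω] {A B : Finset Ω} (h : Disjoint A B)
    (ω : Ω) : containmentMap ω (A ∪ B) = containmentMap ω A + containmentMap ω B := by
  have hω : ω ∈ A → ω ∉ B := fun hA => Finset.disjoint_left.mp h hA
  unfold containmentMap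
  by_cases hA : ω ∈ A <;> by_cases hB : ω ∈ B <;> simp_all

theorem ZMod.two_eq_zero : (2 : ZMod 2) = 0 := by decide

namespace Grade2Additive

theorem add {Ω : Type*} [DecidableEq Ω] {φ ψ : Finset Ω → ZMod 2} (hφ : Grade2Additive φ)
    (hψ : Grade2Additive ψ) : Grade2Additive fun A => φ A + ψ A := by
  intro A B C hAB hAC hBC
  simp only [hφ A B C hAB hAC hBC, hψ A B C hAB hAC hBC]
  ring

theorem sum {Ω ι : Type*} [DecidableEq Ω] (s : Finset ι) {φ : ι → Finset Ω → ZMod 2}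
    (hφ : ∀ i, Grade2Additive (φ i)) : Grade2Additive fun A => ∑ i ∈ s, φ i A := by
  intro A B C hAB hAC hBC
  simp only [← Finset.sum_add_distrib]
  exact Finset.sum_congr rfl fun i _ => hφ i A B C hAB hAC hBC

theorem linear {Ω : Type*} [DecidableEq Ω] (c : ZMod 2) (ω : Ω) :
    Grade2Additive fun A => c * containmentMap ω A := by
  intro A B C hAB hAC hBC
  simp only [containmentMap_union (Finset.disjoint_union_left.mpr ⟨hAC, hBC⟩),
    containmentMap_union hAB, containmentMap_union hAC, containmentMap_union hBC]
  linear_combination -(c * (containmentMap ω A + containmentMap ω B + containmentMap ω C)) *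
    ZMod.two_eq_zero

theorem quadratic {Ω : Type*} [DecidableEq Ω] (c : ZMod 2) (ω ω' : Ω) :
    Grade2Additive fun A => c * containmentMap ω A * containmentMap ω' A := by
  intro A B C hAB hAC hBC
  simp only [containmentMap_union (Finset.disjoint_union_left.mpr ⟨hAC, hBC⟩),
    containmentMap_union hAB, containmentMap_union hAC, containmentMap_union hBC]
  linear_combination -(c * (containmentMap ω A * containmentMap ω' A +
    containmentMap ω B * containmentMap ω' B + containmentMap ω C * containmentMap ω' C)) *
    ZMod.two_eq_zero

theorem map_empty {Ω : Type*} [DecidableEq Ω] {φ : Finset Ω → ZMod 2} (h : Grade2Additive φ) :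
    φ ∅ = 0 := by
  have h0 := h ∅ ∅ ∅ (by simp) (by simp) (by simp)
  simp only [Finset.union_empty] at h0
  linear_combination h0 + 3 * φ ∅ * ZMod.two_eq_zero

/-- The interference term of the pair `x, y`. -/
def interference {Ω : Type*} [DecidableEq Ω] (φ : Finset Ω → ZMod 2) (x y : Ω) : ZMod 2 :=
  φ {x, y} + φ {x} + φ {y}

theorem interference_comm {Ω : Type*} [DecidableEq Ω] (φ : Finset Ω → ZMod 2) (x y : Ω) :
    interference φ x y = interference φ y x := by
  simp only [interference, Finset.pair_comm x y]
  ring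

theorem map_insert {Ω : Type*} [DecidableEq Ω] {φ : Finset Ω → ZMod 2} (h : Grade2Additive φ)
    {z : Ω} {A : Finset Ω} (hz : z ∉ A) :
    φ (insert z A) = φ A + φ {z} + ∑ y ∈ A, interference φ z y := by
  induction A using Finset.induction_on with
  | empty => simp [h.map_empty]
  | insert w A hw ih =>
    simp only [Finset.mem_insert, not_or] at hz
    have key := h {z} {w} A (by simpa using hz.1) (by simpa using hz.2) (by simpa using hw)
    simp only [Finset.singleton_union, Finset.insert_union] at key
    rw [key, ih hz.2, Finset.sum_insert hw, interference]
    linear_combination (φ A) * ZMod.two_eq_zero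

theorem eq_sum_interference {Ω : Type*} [DecidableEq Ω] {φ : Finset Ω → ZMod 2}
    (h : Grade2Additive φ) {e : Ω → ℕ} (he : Function.Injective e) (A : Finset Ω) :
    φ A = ∑ x ∈ A, φ {x} +
      ∑ x ∈ A, ∑ y ∈ A, if e x < e y then interference φ x y else 0 := by
  induction A using Finset.induction_on with
  | empty => simp [h.map_empty]
  | insert z A hz ih =>
    have cross : ∑ y ∈ A, interference φ z y =
        ∑ y ∈ A, (if e z < e y then interference φ z y else 0) +
        ∑ y ∈ A, (if e y < e z then interference φ y z else 0) := by
      rw [← Finset.sum_add_distrib]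
      refine Finset.sum_congr rfl fun y hy => ?_
      have hne : e z ≠ e y := fun hzy => hz (he hzy ▸ hy)
      rcases hne.lt_or_gt with hlt | hlt
      · simp [hlt, hlt.not_gt]
      · simp [hlt, hlt.not_gt, interference_comm φ y z]
    simp only [h.map_insert hz, cross, Finset.sum_insert hz, Finset.sum_add_distrib, lt_irrefl,
      if_false]
    rw [ih]
    ring

end Grade2Additive

/-- `φ` is grade-2 additive iff it is a polynomial of degree at most two in the
containment maps:
`φ(A) = Σ_ω a(ω)·ω^*(A) + Σ_{(ω,ω')} b(ω,ω')·ω^*(A)·ω'^*(A)` for all `A`. -/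
theorem statement_5 {Ω : Type*} [Fintype Ω] [DecidableEq Ω]
    (φ : Finset Ω → ZMod 2) :
    Grade2Additive φ ↔
      ∃ (a : Ω → ZMod 2) (b : Ω × Ω → ZMod 2), ∀ A : Finset Ω,
        φ A = ∑ ω : Ω, a ω * containmentMap ω A
            + ∑ p : Ω × Ω, b p * containmentMap p.1 A * containmentMap p.2 A := by
  constructor
  · intro h
    let e : Ω → ℕ := fun ω => Fintype.equivFin Ω ω
    have he : Function.Injective e := Fin.val_injective.comp (Fintype.equivFin Ω).injective
    refine ⟨fun x => φ {x},
      fun p => if e p.1 < e p.2 then Grade2Additive.interference φ p.1 p.2 else 0, fun A => ?_⟩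
    rw [h.eq_sum_interference he A, Fintype.sum_prod_type]
    simp [containmentMap, Finset.sum_ite_mem, ← Finset.sum_filter]
  · rintro ⟨a, b, h⟩
    obtain rfl : φ = _ := funext h
    exact (Grade2Additive.sum _ fun ω => .linear (a ω) ω).add
      (.sum _ fun p => .quadratic (b p) p.1 p.2)
end

section
/- The set of grade-2 additive maps φ: 𝒜 → ZMod 2 is a ZMod 2-linear subspace of the space of all functions from 𝒜 to ZMod 2 of dimension n(n+1)/2, where n = |Ω|; equivalently, its cardinality is 2^{n(n+1)/2}. -/
namespace Grade2Additive

variable {Ω : Type*} [DecidableEq Ω]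

theorem apply_empty {φ : Finset Ω → ZMod 2} (h : Grade2Additive φ) : φ ∅ = 0 := by
  have h0 := h ∅ ∅ ∅ (by simp) (by simp) (by simp)
  simp only [Finset.union_self] at h0
  generalize φ ∅ = x at h0 ⊢
  decide +revert

/-- The submodule of grade-2 additive maps. -/
def submodule (Ω : Type*) [DecidableEq Ω] : Submodule (ZMod 2) (Finset Ω → ZMod 2) where
  carrier := {φ | Grade2Additive φ}
  zero_mem' := by intro A B C _ _ _; simp
  add_mem' := by
    intro φ ψ hφ hψ A B C hAB hAC hBC
    simp only [Pi.add_apply, hφ A B C hAB hAC hBC, hψ A B C hAB hAC hBC]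
    ring
  smul_mem' := by
    intro c φ hφ A B C hAB hAC hBC
    simp only [Pi.smul_apply, smul_eq_mul, hφ A B C hAB hAC hBC]
    ring

/-- A grade-2 additive map vanishing on singletons and pairs vanishes identically. -/
theorem eq_zero_of_forall_pair {φ : Finset Ω → ZMod 2} (h : Grade2Additive φ)
    (hpair : ∀ a b, φ {a, b} = 0) (A : Finset Ω) : φ A = 0 := by
  have hsingle : ∀ a, φ {a} = 0 := fun a => by simpa using hpair a a
  induction A using Finset.strongInduction with
  | H A ih =>
    obtain rfl | ⟨a, ha⟩ := A.eq_empty_or_nonempty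
    · exact h.apply_empty
    obtain hB | ⟨b, hb⟩ := (A.erase a).eq_empty_or_nonempty
    · rw [← Finset.insert_erase ha, hB]
      exact hsingle a
    have hab : a ≠ b := (Finset.ne_of_mem_erase hb).symm
    have hbA : b ∈ A := Finset.mem_of_mem_erase hb
    set C := (A.erase a).erase b with hC
    have hA : A = {a} ∪ {b} ∪ C := by
      ext x
      simp only [hC, Finset.mem_union, Finset.mem_singleton, Finset.mem_erase]
      grind
    have h1 : φ ({a} ∪ C) = 0 := ih _ <| by
      rw [Finset.ssubset_iff_of_subset (by grind)]
      exact ⟨b, hbA, by grind⟩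
    have h2 : φ ({b} ∪ C) = 0 := ih _ <| by
      rw [Finset.ssubset_iff_of_subset (by grind)]
      exact ⟨a, ha, by grind⟩
    have h3 : φ C = 0 := ih _ <| by
      rw [Finset.ssubset_iff_of_subset (by grind)]
      exact ⟨a, ha, by grind⟩
    have h4 : φ ({a} ∪ {b}) = 0 := hpair a b
    rw [hA, h {a} {b} C (by simpa using hab) (by simp [hC]) (by simp [hC]),
      h1, h2, h3, h4, hsingle, hsingle]
    simp

theorem sum_sym2 (g : Sym2 Ω → ZMod 2) :
    Grade2Additive fun A : Finset Ω => ∑ s ∈ A.sym2, g s := by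
  intro A B C hAB hAC hBC
  have key (D : Finset Ω) (hD : D ⊆ A ∪ B ∪ C) :
      ∑ s ∈ D.sym2, g s = ∑ s ∈ (A ∪ B ∪ C).sym2, if s ∈ D.sym2 then g s else 0 := by
    rw [← Finset.sum_filter, Finset.filter_mem_eq_inter,
      Finset.inter_eq_right.mpr (Finset.sym2_mono hD)]
  simp only [key (A ∪ B) (by grind), key (A ∪ C) (by grind), key (B ∪ C) (by grind),
    key A (by grind), key B (by grind), key C (by grind), ← Finset.sum_add_distrib]
  refine Finset.sum_congr rfl fun s hs => ?_
  induction s with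
  | h a b =>
    rw [Finset.disjoint_left] at hAB hAC hBC
    have htwo : g s(a, b) + g s(a, b) = 0 := CharTwo.add_self_eq_zero _
    simp only [Finset.mk_mem_sym2_iff, Finset.mem_union] at hs ⊢
    grind

/-- The map sending a function `g` on unordered pairs to `A ↦ ∑ s ∈ A.sym2, g s`. -/
def ofSym2 (Ω : Type*) [DecidableEq Ω] : (Sym2 Ω → ZMod 2) →ₗ[ZMod 2] submodule Ω where
  toFun g := ⟨fun A => ∑ s ∈ A.sym2, g s, sum_sym2 g⟩
  map_add' g g' := by ext A; simp [Finset.sum_add_distrib]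
  map_smul' c g := by ext A; simp [Finset.mul_sum]

theorem ofSym2_injective : Function.Injective (ofSym2 Ω) := by
  rw [← LinearMap.ker_eq_bot, LinearMap.ker_eq_bot']
  intro g hg
  have hsum (A : Finset Ω) : ∑ s ∈ A.sym2, g s = 0 := congrFun (congrArg Subtype.val hg) A
  have hdiag (a : Ω) : g s(a, a) = 0 := by simpa [Sym2.diag] using hsum {a}
  ext s
  induction s with
  | h a b =>
    obtain rfl | hab := eq_or_ne a b
    · exact hdiag a
    have hs : ({a, b} : Finset Ω).sym2 = {s(a, a), s(a, b), s(b, b)} := by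
      ext s
      induction s with
      | h x y =>
        simp only [Finset.mk_mem_sym2_iff, Finset.mem_insert, Finset.mem_singleton, Sym2.eq_iff]
        tauto
    have h := hsum {a, b}
    rw [hs, Finset.sum_insert (by simp [hab]), Finset.sum_insert (by simp [hab]),
      Finset.sum_singleton, hdiag, hdiag] at h
    simpa using h

/-- Restriction of a grade-2 additive map to the sets of one or two elements. -/
def toSym2 (Ω : Type*) [DecidableEq Ω] : submodule Ω →ₗ[ZMod 2] (Sym2 Ω → ZMod 2) where
  toFun φ s := φ.1 s.toFinset
  map_add' _ _ := rfl
  map_smul' _ _ := rfl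

theorem toSym2_injective : Function.Injective (toSym2 Ω) := by
  rw [← LinearMap.ker_eq_bot, LinearMap.ker_eq_bot']
  rintro ⟨φ, hφ⟩ h
  refine Subtype.ext (funext (eq_zero_of_forall_pair hφ fun a b => ?_))
  simpa [toSym2, Sym2.toFinset_mk_eq] using congrFun h s(a, b)

theorem finrank_submodule [Fintype Ω] :
    Module.finrank (ZMod 2) (submodule Ω) = Fintype.card Ω * (Fintype.card Ω + 1) / 2 := by
  have h := le_antisymm (LinearMap.finrank_le_finrank_of_injective (toSym2_injective (Ω := Ω)))
    (LinearMap.finrank_le_finrank_of_injective (ofSym2_injective (Ω := Ω)))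
  rw [h, Module.finrank_fintype_fun_eq_card, Sym2.card, Nat.choose_two_right,
    Nat.add_sub_cancel, mul_comm]

end Grade2Additive

/-- The set of grade-2 additive maps `𝒜 → ZMod 2` is a `ZMod 2`-linear subspace of
the space of all functions `𝒜 → ZMod 2`, of dimension `n(n+1)/2` where `n = |Ω|`;
equivalently, its cardinality is `2^(n(n+1)/2)`. -/
theorem statement_7 {Ω : Type*} [Fintype Ω] [DecidableEq Ω] :
    ∃ W : Submodule (ZMod 2) (Finset Ω → ZMod 2),
      (W : Set (Finset Ω → ZMod 2)) = {φ | Grade2Additive φ} ∧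
      Module.finrank (ZMod 2) W = Fintype.card Ω * (Fintype.card Ω + 1) / 2 ∧
      Nat.card W = 2 ^ (Fintype.card Ω * (Fintype.card Ω + 1) / 2) := by
  refine ⟨Grade2Additive.submodule Ω, rfl, Grade2Additive.finrank_submodule, ?_⟩
  rw [Module.natCard_eq_pow_finrank (K := ZMod 2), Grade2Additive.finrank_submodule,
    Nat.card_zmod]
end

section
/- A map φ: 𝒜 → ZMod 2 is grade-2 additive if and only if φ(A ∪ B) = φ(A) + φ(B) + φ(A ∩ B) + φ(A+B) + φ(A ∩ Bᶜ) + φ(Aᶜ ∩ B) for all A,B ∈ 𝒜, where A+B denotes symmetric difference and Aᶜ the complement in Ω. -/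
/-- `φ` is grade-2 additive iff
`φ(A ∪ B) = φ(A) + φ(B) + φ(A ∩ B) + φ(A+B) + φ(A ∩ Bᶜ) + φ(Aᶜ ∩ B)`
for all `A, B ∈ 𝒜` (`A+B` the symmetric difference, `ᶜ` the complement in `Ω`). -/
theorem statement_9 {Ω : Type*} [Fintype Ω] [DecidableEq Ω]
    (φ : Finset Ω → ZMod 2) :
    Grade2Additive φ ↔
      ∀ A B : Finset Ω,
        φ (A ∪ B) = φ A + φ B + φ (A ∩ B) + φ (symmDiff A B)
          + φ (A ∩ Bᶜ) + φ (Aᶜ ∩ B) := by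
  constructor
  · intro h A B
    have key := h (A ∩ Bᶜ) (Aᶜ ∩ B) (A ∩ B)
      (by rw [Finset.disjoint_left]; simp; tauto)
      (by rw [Finset.disjoint_left]; simp; tauto)
      (by rw [Finset.disjoint_left]; simp; tauto)
    have union_eq : A ∩ Bᶜ ∪ Aᶜ ∩ B ∪ A ∩ B = A ∪ B := by ext x; simp; tauto
    have symmDiff_eq : A ∩ Bᶜ ∪ Aᶜ ∩ B = symmDiff A B := by
      ext x; simp [Finset.mem_symmDiff]; tauto
    have left_eq : A ∩ Bᶜ ∪ A ∩ B = A := by ext x; simp; tauto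
    have right_eq : Aᶜ ∩ B ∪ A ∩ B = B := by ext x; simp; tauto
    rw [union_eq, symmDiff_eq, left_eq, right_eq] at key
    rw [key]
    ring
  · intro h A B C hAB hAC hBC
    have key := h (A ∪ C) (B ∪ C)
    rw [Finset.disjoint_left] at hAB hAC hBC
    have union_eq : A ∪ C ∪ (B ∪ C) = A ∪ B ∪ C := by ext x; simp; tauto
    have inter_eq : (A ∪ C) ∩ (B ∪ C) = C := by
      ext x; have := @hAB x; simp; tauto
    have symmDiff_eq : symmDiff (A ∪ C) (B ∪ C) = A ∪ B := by
      ext x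
      have := @hAB x
      have := @hAC x
      have := @hBC x
      simp [Finset.mem_symmDiff]
      tauto
    have left_eq : (A ∪ C) ∩ (B ∪ C)ᶜ = A := by
      ext x; have := @hAB x; have := @hAC x; simp; tauto
    have right_eq : (A ∪ C)ᶜ ∩ (B ∪ C) = B := by
      ext x; have := @hAB x; have := @hBC x; simp; tauto
    rw [union_eq, inter_eq, symmDiff_eq, left_eq, right_eq] at key
    rw [key]
    ring
end

section
/- The poset of projections on V with orthocomplementation P' = I + P is an orthomodular poset: (i) if P ⊥ Q then the least upper bound P ∨ Q exists in (𝒫(V), ≤) and equals P + Q; (ii) if P ≤ Q, then the greatest lower bound Q ∧ P' exists and equals Q + PQ, P ⊥ (Q ∧ P'), and the least upper bound P ∨ (Q ∧ P') exists and equals Q. -/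
/-- A projection on a `ZMod 2`-vector space `V`: a linear idempotent map `V → V`
(multiplication in `Module.End` is composition). -/
def IsProjection {V : Type*} [AddCommGroup V] [Module (ZMod 2) V]
    (P : Module.End (ZMod 2) V) : Prop :=
  P * P = P

/-- The order on projections: `P ≤ Q` iff `PQ = QP = P`. -/
def ProjLE {V : Type*} [AddCommGroup V] [Module (ZMod 2) V]
    (P Q : Module.End (ZMod 2) V) : Prop :=
  P * Q = P ∧ Q * P = P

theorem Module.End.add_self_zmod_two {V : Type*} [AddCommGroup V] [Module (ZMod 2) V]
    (P : Module.End (ZMod 2) V) : P + P = 0 := by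
  rw [← two_smul (ZMod 2) P, show (2 : ZMod 2) = 0 from rfl, zero_smul]

theorem projLE_one_add_iff {V : Type*} [AddCommGroup V] [Module (ZMod 2) V]
    (P Q : Module.End (ZMod 2) V) : ProjLE P (1 + Q) ↔ P * Q = 0 ∧ Q * P = 0 := by
  simp [ProjLE, mul_add, add_mul]

/-- The poset of projections with `P' = I + P` is orthomodular:
(i) if `P ⊥ Q` (i.e. `P ≤ Q'`) then the least upper bound `P ∨ Q` exists and equals
`P + Q`; (ii) if `P ≤ Q` then the greatest lower bound `Q ∧ P'` exists and equals
`Q + PQ`, `P ⊥ (Q ∧ P')`, and the least upper bound `P ∨ (Q ∧ P')` exists and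
equals `Q`. -/
theorem statement_15 {V : Type*} [AddCommGroup V] [Module (ZMod 2) V]
    (P Q : Module.End (ZMod 2) V) (hP : IsProjection P) (hQ : IsProjection Q) :
    (ProjLE P (1 + Q) →
      (IsProjection (P + Q) ∧ ProjLE P (P + Q) ∧ ProjLE Q (P + Q) ∧
        ∀ R : Module.End (ZMod 2) V, IsProjection R →
          ProjLE P R → ProjLE Q R → ProjLE (P + Q) R)) ∧
    (ProjLE P Q →
      (IsProjection (Q + P * Q) ∧
        (ProjLE (Q + P * Q) Q ∧ ProjLE (Q + P * Q) (1 + P) ∧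
          ∀ R : Module.End (ZMod 2) V, IsProjection R →
            ProjLE R Q → ProjLE R (1 + P) → ProjLE R (Q + P * Q)) ∧
        ProjLE P (1 + (Q + P * Q)) ∧
        (ProjLE P Q ∧ ProjLE (Q + P * Q) Q ∧
          ∀ R : Module.End (ZMod 2) V, IsProjection R →
            ProjLE P R → ProjLE (Q + P * Q) R → ProjLE Q R))) := by
  have char_two := Module.End.add_self_zmod_two (V := V)
  rw [IsProjection] at hP hQ
  refine ⟨fun h => ?_, fun h => ?_⟩
  · obtain ⟨hPQ, hQP⟩ := (projLE_one_add_iff P Q).1 h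
    refine ⟨?_, ⟨?_, ?_⟩, ⟨?_, ?_⟩, fun R _ hPR hQR => ⟨?_, ?_⟩⟩
    · simp [IsProjection, mul_add, add_mul, hP, hQ, hPQ, hQP]
    · simp [mul_add, hP, hPQ]
    · simp [add_mul, hP, hQP]
    · simp [mul_add, hQ, hQP]
    · simp [add_mul, hQ, hPQ]
    · rw [add_mul, hPR.1, hQR.1]
    · rw [mul_add, hPR.2, hQR.2]
  · obtain ⟨hPQ, hQP⟩ := id h
    have hQ_add : ProjLE (Q + P) Q := by
      simp [ProjLE, mul_add, add_mul, hQ, hPQ, hQP]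
    simp only [hPQ, projLE_one_add_iff]
    refine ⟨?_, ⟨hQ_add, ⟨?_, ?_⟩, fun R _ hRQ hRP => ⟨?_, ?_⟩⟩, ⟨?_, ?_⟩, h, hQ_add,
      fun R _ hPR hR => ?_⟩
    · simp [IsProjection, mul_add, add_mul, hP, hQ, hPQ, hQP, char_two]
    · simp [add_mul, hP, hQP, char_two]
    · simp [mul_add, hP, hPQ, char_two]
    · rw [mul_add, hRQ.1, hRP.1, add_zero]
    · rw [add_mul, hRQ.2, hRP.2, add_zero]
    · simp [mul_add, hP, hPQ, char_two]
    · simp [add_mul, hP, hQP, char_two]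
    · obtain ⟨hl, hr⟩ := hR
      rw [add_mul, hPR.1] at hl
      rw [mul_add, hPR.2] at hr
      exact ⟨add_right_cancel hl, add_right_cancel hr⟩
end

section
/- (a) For every A ∈ 𝒜 and every coevent φ ∈ 𝒜^*, if P(A)φ = 0 then φ(A) = 0. (b) Consequently, if A₁,…,A_m ∈ 𝒜 and φ ∈ 𝒜^* satisfies P(A₁ ∪ ⋯ ∪ A_m)φ = 0 (φ is precluding), then φ(A_i) = 0 for all i = 1,…,m (φ is preclusive). -/
/-- The projection `P(ω)` on coevents.  On the basis
`{ω_i^*} ∪ {ω_i^*ω_j^*}` of `𝒜^*` it is given by `P(ω)ω^* = ω^*`,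
`P(ω)ω_j^* = ω^*ω_j^*` (`ω_j ≠ ω`), `P(ω)(ω^*ω_j^*) = ω^*ω_j^*` and
`P(ω)(ω_j^*ω_k^*) = 0` for `ω, ω_j, ω_k` distinct; for a coevent
`φ = Σ a_i ω_i^* + Σ b_{ij} ω_i^*ω_j^*` this action is equivalently given by the
intrinsic formula
`(P(ω)φ)(A) = φ({ω}) + Σ_{j ∈ A, j ≠ ω} (φ({ω,j}) + φ({ω}))` if `ω ∈ A`, else `0`
(noting `a_ω = φ({ω})` and `a_j + b_{ωj} = φ({ω,j}) + φ({ω})`). -/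
def Pw {Ω : Type*} [DecidableEq Ω] (ω : Ω) (φ : Finset Ω → ZMod 2) :
    Finset Ω → ZMod 2 := fun A =>
  if ω ∈ A then φ {ω} + ∑ j ∈ A.erase ω, (φ {ω, j} + φ {ω}) else 0

/-- The master observable
`P(A) = Σ_{ω ∈ A} P(ω) + Σ_{ω_i, ω_j ∈ A, i < j} P(ω_i)P(ω_j)`
(sums of compositions; `P(∅) = 0`). -/
def masterObservable {Ω : Type*} [LinearOrder Ω] (A : Finset Ω)
    (φ : Finset Ω → ZMod 2) : Finset Ω → ZMod 2 :=
  (∑ ω ∈ A, Pw ω φ) +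
    ∑ p ∈ (A ×ˢ A).filter (fun p => p.1 < p.2), Pw p.1 (Pw p.2 φ)


/-- A coevent vanishes on the empty set. -/
lemma Grade2Additive.map_empty_s19 {Ω : Type*} [DecidableEq Ω] {φ : Finset Ω → ZMod 2}
    (hφ : Grade2Additive φ) : φ ∅ = 0 := by
  have h := hφ ∅ ∅ ∅ (by simp) (by simp) (by simp)
  simp only [Finset.union_empty] at h
  grind

/-- A coevent that vanishes on the singletons and pairs of `B` vanishes at `B`. -/
lemma Grade2Additive.eq_zero_of_singleton_of_pair {Ω : Type*} [DecidableEq Ω]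
    {φ : Finset Ω → ZMod 2} (hφ : Grade2Additive φ) (B : Finset Ω)
    (h₁ : ∀ i ∈ B, φ {i} = 0) (h₂ : ∀ i ∈ B, ∀ j ∈ B, i ≠ j → φ {i, j} = 0) :
    φ B = 0 := by
  induction B using Finset.strongInduction with
  | H B ih =>
    have hsub : ∀ C ⊂ B, φ C = 0 := fun C hC =>
      ih C hC (fun i hi => h₁ i (hC.1 hi)) (fun i hi j hj => h₂ i (hC.1 hi) j (hC.1 hj))
    rcases B.eq_empty_or_nonempty with rfl | ⟨a, ha⟩
    · exact hφ.map_empty_s19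
    rcases (B.erase a).eq_empty_or_nonempty with he | ⟨b, hb⟩
    · rw [← Finset.insert_erase ha, he]
      exact h₁ a ha
    obtain ⟨hba, hbB⟩ := Finset.mem_erase.mp hb
    set C := (B.erase a).erase b with hC
    have haC : a ∉ C := by simp [hC]
    have hbC : b ∉ C := by simp [hC]
    have hCB : C ⊆ B := (Finset.erase_subset _ _).trans (Finset.erase_subset _ _)
    have hB : {a} ∪ {b} ∪ C = B := by
      ext x
      simp only [hC, Finset.mem_union, Finset.mem_singleton, Finset.mem_erase]
      grind
    have haC' : {a} ∪ C ⊂ B :=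
      (Finset.ssubset_iff_of_subset (by grind)).mpr ⟨b, hbB, by grind⟩
    have hbC' : {b} ∪ C ⊂ B :=
      (Finset.ssubset_iff_of_subset (by grind)).mpr ⟨a, ha, by grind⟩
    have h := hφ {a} {b} C (by simpa using hba.symm) (by simpa using haC) (by simpa using hbC)
    rw [hB, hsub _ haC', hsub _ hbC', h₁ a ha, h₁ b hbB,
      hsub C ((Finset.ssubset_iff_of_subset hCB).mpr ⟨a, ha, haC⟩)] at h
    simpa [← Finset.insert_eq, h₂ a ha b hbB hba.symm] using h

lemma Pw_singleton {Ω : Type*} [DecidableEq Ω] (ω i : Ω) (φ : Finset Ω → ZMod 2) :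
    Pw ω φ {i} = if ω = i then φ {i} else 0 := by
  by_cases h : ω = i
  · subst h
    simp [Pw]
  · simp [Pw, h]

lemma Pw_pair {Ω : Type*} [DecidableEq Ω] (ω : Ω) {i j : Ω} (hij : i ≠ j)
    (φ : Finset Ω → ZMod 2) :
    Pw ω φ {i, j} = if ω = i ∨ ω = j then φ {i, j} else 0 := by
  have cancel : ∀ x y : ZMod 2, x + (y + x) = y := by decide
  by_cases hi : ω = i
  · subst hi
    have he : ({ω, j} : Finset Ω).erase ω = {j} := by grind
    simp [Pw, he, cancel]
  by_cases hj : ω = j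
  · subst hj
    have he : ({i, ω} : Finset Ω).erase ω = {i} := by grind
    simp [Pw, he, cancel, Finset.pair_comm]
  · simp [Pw, hi, hj]

lemma masterObservable_singleton {Ω : Type*} [LinearOrder Ω] {A : Finset Ω} {i : Ω}
    (hi : i ∈ A) (φ : Finset Ω → ZMod 2) : masterObservable A φ {i} = φ {i} := by
  have hcross : ∑ p ∈ (A ×ˢ A).filter (fun p => p.1 < p.2), Pw p.1 (Pw p.2 φ) {i} = 0 := by
    refine Finset.sum_eq_zero fun p hp => ?_
    have hlt := (Finset.mem_filter.mp hp).2
    simp only [Pw_singleton]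
    grind
  simp only [masterObservable, Pi.add_apply, Finset.sum_apply, hcross]
  simp [Pw_singleton, hi]

lemma masterObservable_pair {Ω : Type*} [LinearOrder Ω] {A : Finset Ω} {i j : Ω}
    (hi : i ∈ A) (hj : j ∈ A) (hij : i < j) (φ : Finset Ω → ZMod 2) :
    masterObservable A φ {i, j} = φ {i, j} := by
  have hcross : ∑ p ∈ (A ×ˢ A).filter (fun p => p.1 < p.2), Pw p.1 (Pw p.2 φ) {i, j}
      = φ {i, j} := by
    rw [Finset.sum_eq_single (i, j)]
    · simp [Pw_pair _ hij.ne]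
    · rintro ⟨x, y⟩ hp hne
      have hlt : x < y := (Finset.mem_filter.mp hp).2
      simp only [Pw_pair _ hij.ne]
      grind
    · simp [hi, hj, hij]
  have hlin : ∑ ω ∈ A, Pw ω φ {i, j} = 0 := by
    have hf : A.filter (fun ω => ω = i ∨ ω = j) = {i, j} := by grind
    simp only [Pw_pair _ hij.ne]
    rw [← Finset.sum_filter, hf, Finset.sum_pair hij.ne, CharTwo.add_self_eq_zero]
  simp only [masterObservable, Pi.add_apply, Finset.sum_apply, hcross, hlin, zero_add]

/-- If `P(A)φ = 0`, then the coevent `φ` vanishes on every subset of `A`. -/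
lemma Grade2Additive.eq_zero_of_masterObservable_eq_zero {Ω : Type*} [LinearOrder Ω]
    {φ : Finset Ω → ZMod 2} (hφ : Grade2Additive φ) {A B : Finset Ω} (hBA : B ⊆ A)
    (hA : masterObservable A φ = 0) : φ B = 0 := by
  refine hφ.eq_zero_of_singleton_of_pair B (fun i hi => ?_) (fun i hi j hj hij => ?_)
  · rw [← masterObservable_singleton (hBA hi) φ, hA, Pi.zero_apply]
  · rcases hij.lt_or_gt with h | h
    · rw [← masterObservable_pair (hBA hi) (hBA hj) h φ, hA, Pi.zero_apply]
    · rw [Finset.pair_comm, ← masterObservable_pair (hBA hj) (hBA hi) h φ, hA, Pi.zero_apply]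

/-- (a) For every `A ∈ 𝒜` and coevent `φ`, if `P(A)φ = 0` then `φ(A) = 0`.
(b) Consequently, if `φ` is precluding for `A₁, …, A_m`, i.e.
`P(A₁ ∪ ⋯ ∪ A_m)φ = 0`, then `φ` is preclusive: `φ(A_i) = 0` for all `i`. -/
theorem statement_19 {Ω : Type*} [Fintype Ω] [LinearOrder Ω] :
    (∀ (A : Finset Ω) (φ : Finset Ω → ZMod 2), Grade2Additive φ →
      masterObservable A φ = 0 → φ A = 0) ∧
    (∀ (m : ℕ) (As : Fin m → Finset Ω) (φ : Finset Ω → ZMod 2),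
      Grade2Additive φ →
      masterObservable (Finset.univ.biUnion As) φ = 0 →
      ∀ i : Fin m, φ (As i) = 0) := by
  exact ⟨fun _ _ hφ hA => hφ.eq_zero_of_masterObservable_eq_zero subset_rfl hA,
    fun _ As _ hφ hA i => hφ.eq_zero_of_masterObservable_eq_zero
      (Finset.subset_biUnion_of_mem As (Finset.mem_univ i)) hA⟩
end
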